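/- Let c > 4 be a fixed constant. Then there exists a constant t > 0 (depending only on c) such that almost surely the Erdős–Rényi random graph G(n, c/n) contains at least one rigid component spanning at least t·n vertices. -/

import Mathlib

open MeasureTheory Filter

noncomputable instance {n : ℕ} : MeasurableSpace (SimpleGraph (Fin n)) := ⊤

/-- The Bernoulli(p) measure on `Bool`. -/
noncomputable def bernoulliMeasure (p : ℝ) : Measure Bool :=
  ENNReal.ofReal p • Measure.dirac true + ENNReal.ofReal (1 - p) • Measure.dirac false

/-- The Erdős–Rényi measure on simple graphs on `Fin n`: the pushforward to
`SimpleGraph (Fin n)` of the product Bernoulli(p) measure over unordered pairs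
of distinct vertices. -/
noncomputable def erdosRenyi (n : ℕ) (p : ℝ) : Measure (SimpleGraph (Fin n)) :=
  Measure.map
    (fun f : ({e : Sym2 (Fin n) // ¬ e.IsDiag} → Bool) =>
      SimpleGraph.fromEdgeSet {e : Sym2 (Fin n) | ∃ h : ¬ e.IsDiag, f ⟨e, h⟩ = true})
    (Measure.pi fun _ => bernoulliMeasure p)

/-- The edges of `G` spanned by the vertex set `S`. -/
def spannedEdges {n : ℕ} (G : SimpleGraph (Fin n)) (S : Finset (Fin n)) : Set (Sym2 (Fin n)) :=
  {e | e ∈ G.edgeSet ∧ ∀ v ∈ e, v ∈ S}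

/-- `H` is a (2,3)-tight (Laman) graph on the vertex set `S`: all edges of `H` lie
inside `S`, every subset `T ⊆ S` with `|T| ≥ 2` spans at most `2|T| - 3` edges, and
`H` has exactly `2|S| - 3` edges. -/
def IsTightOn {n : ℕ} (H : SimpleGraph (Fin n)) (S : Finset (Fin n)) : Prop :=
  (∀ e ∈ H.edgeSet, ∀ v ∈ e, v ∈ S) ∧
  (∀ T : Finset (Fin n), T ⊆ S → 2 ≤ T.card →
    (spannedEdges H T).ncard ≤ 2 * T.card - 3) ∧
  H.edgeSet.ncard = 2 * S.card - 3

/-- The induced subgraph `G[S]` is rigid: it contains a spanning (2,3)-tight subgraph. -/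
def IsRigidOn {n : ℕ} (G : SimpleGraph (Fin n)) (S : Finset (Fin n)) : Prop :=
  ∃ H ≤ G, IsTightOn H S

/-- `S` is a rigid component of `G`: `|S| ≥ 2`, `G[S]` is rigid, and `S` is
inclusion-wise maximal with this property. -/
def IsRigidComponent {n : ℕ} (G : SimpleGraph (Fin n)) (S : Finset (Fin n)) : Prop :=
  2 ≤ S.card ∧ IsRigidOn G S ∧
  ∀ S' : Finset (Fin n), S ⊆ S' → IsRigidOn G S' → S' = S

/-- The graph on `Fin n` whose edges are the pairs selected by `f`. -/
def graphOfIndicator {n : ℕ} (f : {e : Sym2 (Fin n) // ¬ e.IsDiag} → Bool) :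
    SimpleGraph (Fin n) :=
  SimpleGraph.fromEdgeSet {e : Sym2 (Fin n) | ∃ h : ¬ e.IsDiag, f ⟨e, h⟩ = true}

lemma edgeSet_graphOfIndicator {n : ℕ} (f : {e : Sym2 (Fin n) // ¬ e.IsDiag} → Bool) :
    (graphOfIndicator f).edgeSet = {e : Sym2 (Fin n) | ∃ h : ¬ e.IsDiag, f ⟨e, h⟩ = true} := by
  ext e
  simp only [graphOfIndicator, SimpleGraph.edgeSet_fromEdgeSet, Set.mem_sdiff, Set.mem_ofPred_eq]
  constructor
  · exact fun h => h.1
  · exact fun h => ⟨h, h.1⟩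

section Deterministic

variable {n : ℕ}

lemma IsRigidOn.exists_isRigidComponent {G : SimpleGraph (Fin n)} {S : Finset (Fin n)}
    (hS : 2 ≤ S.card) (h : IsRigidOn G S) :
    ∃ T, S ⊆ T ∧ IsRigidComponent G T := by
  obtain ⟨T, hST, hT⟩ := (Set.toFinite {T | IsRigidOn G T}).exists_le_maximal h
  refine ⟨T, hST, hS.trans (Finset.card_le_card hST), hT.prop, fun S' hS' hr => ?_⟩
  exact (hT.eq_of_le hr hS').symm

lemma exists_isRigidOn_of_le_ncard_edgeSet (hn : 2 ≤ n) {G : SimpleGraph (Fin n)}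
    (hG : 2 * n - 2 ≤ G.edgeSet.ncard) :
    ∃ S : Finset (Fin n), 2 ≤ S.card ∧ 2 * S.card - 2 ≤ (spannedEdges G S).ncard ∧
      IsRigidOn G S := by
  have huniv : (Finset.univ : Finset (Fin n)) ∈ {S : Finset (Fin n) |
      2 ≤ S.card ∧ 2 * S.card - 2 ≤ (spannedEdges G S).ncard} := by
    simpa [spannedEdges] using ⟨hn, by simpa using hG⟩
  obtain ⟨S, -, hS⟩ := (Set.toFinite _).exists_le_minimal huniv
  obtain ⟨h2, hle⟩ := hS.prop
  refine ⟨S, h2, hle, ?_⟩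
  obtain ⟨D, hDS, hD⟩ := Set.exists_subset_card_eq
    (show 2 * S.card - 3 ≤ (spannedEdges G S).ncard by omega)
  have hDG : D ⊆ G.edgeSet := fun e he => (hDS he).1
  have hedge : (SimpleGraph.fromEdgeSet D).edgeSet = D := by
    rw [SimpleGraph.edgeSet_fromEdgeSet, sdiff_eq_left, Set.disjoint_left]
    exact fun e he hd => G.not_isDiag_of_mem_edgeSet (hDG he) hd
  refine ⟨SimpleGraph.fromEdgeSet D, ?_, ?_, ?_, ?_⟩
  · rw [← SimpleGraph.edgeSet_subset_edgeSet, hedge]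
    exact hDG
  · rw [hedge]
    exact fun e he => (hDS he).2
  · intro T hTS hT
    rcases eq_or_ne T S with rfl | hne
    · rw [← hD]
      exact Set.ncard_le_ncard fun e he => hedge ▸ he.1
    · by_contra! hlt
      have hmono : (spannedEdges (SimpleGraph.fromEdgeSet D) T).ncard ≤
          (spannedEdges G T).ncard :=
        Set.ncard_le_ncard fun e he => ⟨hDG (hedge ▸ he.1), he.2⟩
      exact hne (hS.eq_of_le ⟨hT, by omega⟩ hTS)
  · rw [hedge, hD]

end Deterministic

section Measure

variable {p : ℝ}

lemma isProbabilityMeasure_bernoulliMeasure (hp0 : 0 ≤ p) (hp1 : p ≤ 1) :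
    IsProbabilityMeasure (bernoulliMeasure p) := by
  refine ⟨?_⟩
  simp [bernoulliMeasure, ← ENNReal.ofReal_add hp0 (sub_nonneg.2 hp1)]

lemma bernoulliMeasure_singleton_true (p : ℝ) :
    bernoulliMeasure p {true} = ENNReal.ofReal p := by
  simp [bernoulliMeasure]

lemma integral_bernoulliMeasure (hp0 : 0 ≤ p) (hp1 : p ≤ 1) (g : Bool → ℝ) :
    ∫ b, g b ∂bernoulliMeasure p = p * g true + (1 - p) * g false := by
  rw [bernoulliMeasure, integral_add_measure
    (Integrable.of_finite.smul_measure ENNReal.ofReal_ne_top)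
    (Integrable.of_finite.smul_measure ENNReal.ofReal_ne_top), integral_smul_measure,
    integral_smul_measure, integral_dirac, integral_dirac, ENNReal.toReal_ofReal hp0,
    ENNReal.toReal_ofReal (sub_nonneg.2 hp1), smul_eq_mul, smul_eq_mul]

variable {ι : Type*} [Fintype ι]

lemma pi_bernoulliMeasure_forall_mem (hp0 : 0 ≤ p) (hp1 : p ≤ 1) (F : Finset ι) :
    Measure.pi (fun _ : ι => bernoulliMeasure p) {f | ∀ i ∈ F, f i = true} =
      ENNReal.ofReal p ^ F.card := by
  classical
  have := isProbabilityMeasure_bernoulliMeasure hp0 hp1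
  have hset : {f : ι → Bool | ∀ i ∈ F, f i = true} =
      Set.univ.pi fun i => if i ∈ F then {true} else Set.univ := by
    ext f
    simp only [Set.mem_ofPred_eq, Set.mem_univ_pi]
    refine forall_congr' fun i => ?_
    by_cases hi : i ∈ F <;> simp [hi]
  rw [hset, Measure.pi_pi]
  simp_rw [apply_ite (bernoulliMeasure p), measure_univ, bernoulliMeasure_singleton_true]
  simp

/-- Union bound: the chance that at least `j` of the coordinates in `F` are selected. -/
lemma pi_bernoulliMeasure_le_card_filter (hp0 : 0 ≤ p) (hp1 : p ≤ 1) (F : Finset ι) (j : ℕ) :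
    (Measure.pi (fun _ : ι => bernoulliMeasure p)).real
      {f | j ≤ (F.filter fun i => f i = true).card} ≤ F.card.choose j * p ^ j := by
  classical
  refine ENNReal.toReal_le_of_le_ofReal (by positivity) ?_
  calc _ ≤ Measure.pi (fun _ : ι => bernoulliMeasure p)
        (⋃ A ∈ F.powersetCard j, {f | ∀ i ∈ A, f i = true}) := by
        refine measure_mono fun f hf => ?_
        obtain ⟨A, hA, hAj⟩ := Finset.exists_subset_card_eq hf
        simp only [Set.mem_iUnion, Finset.mem_powersetCard]
        exact ⟨A, ⟨hA.trans (Finset.filter_subset _ _), hAj⟩,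
          fun i hi => (Finset.mem_filter.1 (hA hi)).2⟩
    _ ≤ ∑ A ∈ F.powersetCard j,
        Measure.pi (fun _ : ι => bernoulliMeasure p) {f | ∀ i ∈ A, f i = true} :=
        measure_biUnion_finset_le _ _
    _ = ∑ A ∈ F.powersetCard j, ENNReal.ofReal p ^ j := by
        refine Finset.sum_congr rfl fun A hA => ?_
        rw [pi_bernoulliMeasure_forall_mem hp0 hp1, (Finset.mem_powersetCard.1 hA).2]
    _ = _ := by
        rw [Finset.sum_const, Finset.card_powersetCard, nsmul_eq_mul,
          ENNReal.ofReal_mul (by positivity), ENNReal.ofReal_natCast, ENNReal.ofReal_pow hp0]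

/-- Chernoff bound for the lower tail of a binomial variable. -/
lemma pi_bernoulliMeasure_card_filter_lt (hp0 : 0 ≤ p) (hp1 : p ≤ 1) {s : ℝ} (hs0 : 0 < s)
    (hs1 : s ≤ 1) (m : ℕ) :
    (Measure.pi (fun _ : ι => bernoulliMeasure p)).real
      {f | (Finset.univ.filter fun i => f i = true).card < m} ≤
      (1 - p * (1 - s)) ^ Fintype.card ι / s ^ m := by
  have := isProbabilityMeasure_bernoulliMeasure hp0 hp1
  set μ := Measure.pi (fun _ : ι => bernoulliMeasure p)
  set g : Bool → ℝ := fun b => if b = true then s else 1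
  have hg : ∀ b, 0 ≤ g b := fun b => by cases b <;> simp [g, hs0.le]
  have hint : ∫ f, ∏ i, g (f i) ∂μ = (1 - p * (1 - s)) ^ Fintype.card ι := by
    rw [integral_fintype_prod_eq_prod (fun _ => g)]
    simp only [integral_bernoulliMeasure hp0 hp1, Finset.prod_const, Finset.card_univ]
    congr 1
    simp [g]
    ring
  rw [le_div_iff₀ (by positivity), mul_comm, ← hint]
  refine le_trans ?_ (mul_meas_ge_le_integral_of_nonneg
    (ae_of_all _ fun f => Finset.prod_nonneg fun i _ => hg _) .of_finite (s ^ m))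
  refine mul_le_mul_of_nonneg_left (measureReal_mono fun f hf => ?_) (by positivity)
  simp only [Set.mem_ofPred_eq, g, Finset.prod_ite, Finset.prod_const, one_pow, mul_one] at hf ⊢
  exact pow_le_pow_of_le_one hs0.le hs1 hf.le

end Measure

section ErdosRenyi

variable {n : ℕ}

/-- The pairs of distinct vertices with both elements in `S`. -/
def pairsWithin (S : Finset (Fin n)) : Finset {e : Sym2 (Fin n) // ¬ e.IsDiag} :=
  Finset.univ.filter fun e => ∀ v ∈ e.1, v ∈ S

lemma card_pairsWithin (S : Finset (Fin n)) : (pairsWithin S).card = S.card.choose 2 := by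
  classical
  rw [← Sym2.card_image_offDiag, ← Finset.card_map (Function.Embedding.subtype _)]
  congr 1
  ext e
  induction e with
  | _ a b =>
    simp only [pairsWithin, Finset.mem_map, Finset.mem_filter, Finset.mem_univ, true_and,
      Function.Embedding.subtype_apply, Subtype.exists, Finset.mem_image, Finset.mem_offDiag,
      Prod.exists, Function.uncurry]
    constructor
    · rintro ⟨e, he, h, rfl⟩
      exact ⟨a, b, ⟨h a (by simp), h b (by simp), by simpa using he⟩, rfl⟩
    · rintro ⟨x, y, ⟨hx, hy, hxy⟩, h⟩
      exact ⟨s(x, y), by simpa using hxy, by simp [hx, hy], h⟩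

lemma ncard_spannedEdges_graphOfIndicator (f : {e : Sym2 (Fin n) // ¬ e.IsDiag} → Bool)
    (S : Finset (Fin n)) :
    (spannedEdges (graphOfIndicator f) S).ncard =
      ((pairsWithin S).filter fun e => f e = true).card := by
  classical
  rw [← Finset.card_map (Function.Embedding.subtype _), ← Set.ncard_coe_finset]
  congr 1
  ext e
  simp [spannedEdges, edgeSet_graphOfIndicator, pairsWithin]
  tauto

lemma ncard_edgeSet_graphOfIndicator (f : {e : Sym2 (Fin n) // ¬ e.IsDiag} → Bool) :
    (graphOfIndicator f).edgeSet.ncard = (Finset.univ.filter fun e => f e = true).card := by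
  simpa [spannedEdges, pairsWithin] using
    ncard_spannedEdges_graphOfIndicator f Finset.univ

instance : DiscreteMeasurableSpace (SimpleGraph (Fin n)) := ⟨fun _ => trivial⟩

lemma erdosRenyi_eq_map (n : ℕ) (p : ℝ) :
    erdosRenyi n p = Measure.map graphOfIndicator (Measure.pi fun _ => bernoulliMeasure p) := rfl

lemma isProbabilityMeasure_erdosRenyi {p : ℝ} (hp0 : 0 ≤ p) (hp1 : p ≤ 1) :
    IsProbabilityMeasure (erdosRenyi n p) := by
  have := isProbabilityMeasure_bernoulliMeasure hp0 hp1
  exact Measure.isProbabilityMeasure_map (Measurable.of_discrete).aemeasurable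

lemma erdosRenyi_real_apply (p : ℝ) (A : Set (SimpleGraph (Fin n))) :
    (erdosRenyi n p).real A =
      (Measure.pi fun _ => bernoulliMeasure p).real (graphOfIndicator ⁻¹' A) := by
  rw [erdosRenyi_eq_map, map_measureReal_apply Measurable.of_discrete .of_discrete]

lemma erdosRenyi_real_le_ncard_spannedEdges {p : ℝ} (hp0 : 0 ≤ p) (hp1 : p ≤ 1)
    (S : Finset (Fin n)) (j : ℕ) :
    (erdosRenyi n p).real {G | j ≤ (spannedEdges G S).ncard} ≤
      (S.card.choose 2).choose j * p ^ j := by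
  rw [erdosRenyi_real_apply, ← card_pairsWithin]
  simpa only [Set.preimage_ofPred_eq, ncard_spannedEdges_graphOfIndicator] using
    pi_bernoulliMeasure_le_card_filter hp0 hp1 (pairsWithin S) j

lemma erdosRenyi_real_ncard_edgeSet_lt {p : ℝ} (hp0 : 0 ≤ p) (hp1 : p ≤ 1) {s : ℝ} (hs0 : 0 < s)
    (hs1 : s ≤ 1) (m : ℕ) :
    (erdosRenyi n p).real {G | G.edgeSet.ncard < m} ≤
      (1 - p * (1 - s)) ^ n.choose 2 / s ^ m := by
  rw [erdosRenyi_real_apply]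
  simpa only [Set.preimage_ofPred_eq, ncard_edgeSet_graphOfIndicator, Sym2.card_subtype_not_diag,
    Fintype.card_fin] using pi_bernoulliMeasure_card_filter_lt
      (ι := {e : Sym2 (Fin n) // ¬ e.IsDiag}) hp0 hp1 hs0 hs1 m

/-- First moment bound for sets of fewer than `r` vertices spanning at least `2k - 2` edges. -/
lemma erdosRenyi_real_exists_dense_le {p : ℝ} (hp0 : 0 ≤ p) (hp1 : p ≤ 1) (r : ℝ) :
    (erdosRenyi n p).real {G | ∃ S : Finset (Fin n), 2 ≤ S.card ∧ (S.card : ℝ) < r ∧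
      2 * S.card - 2 ≤ (spannedEdges G S).ncard} ≤
    ∑ k ∈ Finset.range (n + 1), (n.choose k : ℝ) * if 2 ≤ k ∧ (k : ℝ) < r then
      ((k.choose 2).choose (2 * k - 2) : ℝ) * p ^ (2 * k - 2) else 0 := by
  classical
  have := isProbabilityMeasure_erdosRenyi (n := n) hp0 hp1
  set g : ℕ → ℝ := fun k => if 2 ≤ k ∧ (k : ℝ) < r then
      ((k.choose 2).choose (2 * k - 2) : ℝ) * p ^ (2 * k - 2) else 0 with hg
  calc _ ≤ (erdosRenyi n p).real (⋃ S ∈ (Finset.univ : Finset (Fin n)).powerset,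
        {G | 2 ≤ S.card ∧ (S.card : ℝ) < r ∧ 2 * S.card - 2 ≤ (spannedEdges G S).ncard}) := by
        refine measureReal_mono (fun G hG => ?_) (measure_ne_top _ _)
        obtain ⟨S, hS⟩ := hG
        simp only [Set.mem_iUnion]
        exact ⟨S, by simp, hS⟩
    _ ≤ ∑ S ∈ (Finset.univ : Finset (Fin n)).powerset, (erdosRenyi n p).real
        {G | 2 ≤ S.card ∧ (S.card : ℝ) < r ∧ 2 * S.card - 2 ≤ (spannedEdges G S).ncard} :=
        measureReal_biUnion_finset_le _ _
    _ ≤ ∑ S ∈ (Finset.univ : Finset (Fin n)).powerset, g S.card := by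
        refine Finset.sum_le_sum fun S _ => ?_
        by_cases hS : 2 ≤ S.card ∧ (S.card : ℝ) < r
        · simp only [hg, if_pos hS]
          exact (measureReal_mono fun G hG => hG.2.2).trans
            (erdosRenyi_real_le_ncard_spannedEdges hp0 hp1 S _)
        · simp only [hg, if_neg hS, ← and_assoc, hS, false_and]
          simp
    _ = _ := by
        rw [Finset.sum_powerset_apply_card]
        simp [hg]

end ErdosRenyi

section Asymptotics

lemma Nat.choose_le_exp_mul_div_pow (m : ℕ) {j : ℕ} (hj : j ≠ 0) :
    (m.choose j : ℝ) ≤ (Real.exp 1 * (m / j)) ^ j := by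
  have hj' : (j : ℝ) ≠ 0 := by exact_mod_cast hj
  calc (m.choose j : ℝ) ≤ m ^ j / j.factorial := Nat.choose_le_pow_div j m
    _ = (m / j : ℝ) ^ j * (j ^ j / j.factorial) := by
        rw [div_pow]
        field_simp
    _ ≤ (m / j : ℝ) ^ j * Real.exp j := by
        gcongr
        exact Real.pow_div_factorial_le_exp _ (by positivity) _
    _ = _ := by rw [mul_pow, ← Real.exp_nat_mul, mul_one, mul_comm]

lemma choose_mul_choose_mul_pow_le {c B : ℝ} (hc : 4 ≤ c)
    (hB : B = Real.exp 1 * (Real.exp 1 * c / 4) ^ 2) {n j : ℕ} (hn : n ≠ 0)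
    (h : B * ((j + 3 : ℕ) / n) ≤ 1 / 2) :
    (n.choose (j + 3) : ℝ) * ((((j + 3).choose 2).choose (2 * (j + 3) - 2) : ℝ) *
      (c / n) ^ (2 * (j + 3) - 2)) ≤ 8 * B ^ 3 / n * ((j + 3 : ℕ) * (1 / 2) ^ (j + 3)) := by
  set k := j + 3 with hk
  set e := Real.exp 1
  have he : 1 ≤ e := Real.one_le_exp zero_le_one
  set a := e * c / 4
  have ha : 1 ≤ a := by simp only [a]; nlinarith
  have hn0 : (0 : ℝ) < n := by positivity
  have hk0 : (0 : ℝ) < k := by positivity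
  set x : ℝ := k / n with hx
  have hx0 : 0 < x := by positivity
  have hB0 : 0 < B := by rw [hB]; positivity
  have h1 : (n.choose k : ℝ) ≤ (e / x) ^ k := by
    refine (Nat.choose_le_exp_mul_div_pow n (by omega)).trans_eq ?_
    rw [hx]
    congr 1
    simp only [e]
    field_simp
  have h2 : ((k.choose 2).choose (2 * k - 2) : ℝ) * (c / n) ^ (2 * k - 2) ≤
      (a * x) ^ (2 * k - 2) := by
    have hdiv : ((k.choose 2 : ℕ) : ℝ) / (2 * k - 2 : ℕ) = k / 4 := by
      rw [Nat.cast_choose_two, hk]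
      have : 2 * (j + 3) - 2 = 2 * (j + 2) := by omega
      rw [this]
      push_cast
      field_simp
      ring
    calc _ ≤ (e * (k / 4)) ^ (2 * k - 2) * (c / n) ^ (2 * k - 2) := by
          gcongr
          exact hdiv ▸ Nat.choose_le_exp_mul_div_pow _ (by omega)
      _ = _ := by
          rw [← mul_pow, hx]
          congr 1
          simp only [a]
          ring
  calc _ ≤ (e / x) ^ k * (a * x) ^ (2 * k - 2) := by gcongr
    _ = e ^ (j + 3) * a ^ (2 * j + 4) * x ^ (j + 1) := by
        have : 2 * k - 2 = (j + 3) + (j + 1) := by omega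
        rw [this, hk, div_pow, mul_pow, pow_add x]
        field_simp
        ring
    _ ≤ e ^ (j + 3) * a ^ (2 * j + 6) * x ^ (j + 1) := by
        gcongr
        omega
    _ = B ^ 3 * x * (B * x) ^ j := by
        rw [hB]
        ring_nf
    _ ≤ B ^ 3 * x * (1 / 2) ^ j := by gcongr
    _ = _ := by
        rw [hx, hk, pow_add (1 / 2 : ℝ)]
        ring

lemma erdosRenyi_real_exists_small_dense_le {c B : ℝ} (hc : 4 ≤ c)
    (hB : B = Real.exp 1 * (Real.exp 1 * c / 4) ^ 2) {n : ℕ} (hn : c ≤ n) :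
    (erdosRenyi n (c / n)).real {G | ∃ S : Finset (Fin n), 2 ≤ S.card ∧
      (S.card : ℝ) < 1 / (2 * B) * n ∧ 2 * S.card - 2 ≤ (spannedEdges G S).ncard} ≤
    16 * B ^ 3 / n := by
  have hn0 : (0 : ℝ) < n := by linarith
  have hB0 : 0 < B := by rw [hB]; positivity
  have hsum : HasSum (fun k : ℕ => (k : ℝ) * (1 / 2) ^ k) 2 := by
    have h := hasSum_coe_mul_geometric_of_norm_lt_one (r := (1 / 2 : ℝ)) (by norm_num)
    rwa [show (1 / 2 : ℝ) / (1 - 1 / 2) ^ 2 = 2 by norm_num] at h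
  calc _ ≤ _ := erdosRenyi_real_exists_dense_le (by positivity) (div_le_one_of_le₀ hn hn0.le) _
    _ ≤ ∑ k ∈ Finset.range (n + 1), 8 * B ^ 3 / n * (k * (1 / 2) ^ k) := by
        refine Finset.sum_le_sum fun k _ => ?_
        split_ifs with h
        · obtain rfl | ⟨j, rfl⟩ : k = 2 ∨ ∃ j, k = j + 3 := by
            rcases h.1.eq_or_lt with h2 | h3
            · exact .inl h2.symm
            · exact .inr ⟨k - 3, by omega⟩
          · simp
            positivity
          · refine choose_mul_choose_mul_pow_le hc hB (by exact_mod_cast hn0.ne') ?_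
            have := h.2
            field_simp at this ⊢
            linarith
        · rw [mul_zero]
          positivity
    _ ≤ 8 * B ^ 3 / n * 2 := by
        rw [← Finset.mul_sum]
        gcongr
        exact sum_le_hasSum _ (fun k _ => by positivity) hsum
    _ = _ := by ring

lemma erdosRenyi_real_few_edges_le {c : ℝ} (hc : 4 ≤ c) {n : ℕ} (hn : c ≤ n) :
    (erdosRenyi n (c / n)).real {G | G.edgeSet.ncard < 2 * n - 2} ≤
      ((c / 4 * Real.exp (-(c / 4 - 1))) ^ 2) ^ (n - 1) := by
  have hn0 : (0 : ℝ) < n := by linarith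
  have hc0 : 0 < c := by linarith
  have hp1 : c / n ≤ 1 := div_le_one_of_le₀ hn hn0.le
  obtain ⟨m, rfl⟩ : ∃ m, n = m + 1 := Nat.exists_eq_add_one.2 (by exact_mod_cast hn0)
  refine (erdosRenyi_real_ncard_edgeSet_lt (by positivity) hp1 (s := 4 / c) (by positivity)
    (div_le_one_of_le₀ hc hc0.le) _).trans ?_
  have h0 : 0 ≤ 1 - c / (m + 1 : ℕ) * (1 - 4 / c) := by
    have h1 : 0 ≤ 1 - 4 / c := sub_nonneg.2 (div_le_one_of_le₀ hc hc0.le)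
    have h2 : 1 - 4 / c ≤ 1 := sub_le_self _ (by positivity)
    exact sub_nonneg.2 (mul_le_one₀ hp1 h1 h2)
  calc _ ≤ Real.exp (-(c / (m + 1 : ℕ) * (1 - 4 / c))) ^ (m + 1).choose 2 /
        (4 / c) ^ (2 * (m + 1) - 2) := by
        gcongr
        linarith [Real.add_one_le_exp (-(c / (m + 1 : ℕ) * (1 - 4 / c)))]
    _ = (c / 4) ^ (2 * m) * Real.exp (-(c / 4 - 1)) ^ (2 * m) := by
        rw [show 2 * (m + 1) - 2 = 2 * m by omega, ← Real.exp_nat_mul, ← Real.exp_nat_mul,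
          Nat.cast_choose_two, div_eq_mul_inv, ← inv_pow, inv_div, mul_comm]
        congr 2
        push_cast
        field_simp
        ring
    _ = _ := by rw [← mul_pow, ← pow_mul, Nat.add_sub_cancel]

end Asymptotics

/-- For a fixed constant `c > 4`, there is a constant `t > 0` such that almost surely
`G(n, c/n)` contains at least one rigid component spanning at least `t·n` vertices. -/
theorem large_rigid_component_exists (c : ℝ) (hc : 4 < c) :
    ∃ t : ℝ, 0 < t ∧
      Tendsto (fun n : ℕ =>
        erdosRenyi n (c / n)
          {G | ∃ S : Finset (Fin n), IsRigidComponent G S ∧ t * n ≤ (S.card : ℝ)})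
        atTop (nhds 1) := by
  set B := Real.exp 1 * (Real.exp 1 * c / 4) ^ 2 with hB
  have hB0 : 0 < B := by positivity
  set q := (c / 4 * Real.exp (-(c / 4 - 1))) ^ 2
  have hq : q < 1 := by
    refine pow_lt_one₀ (by positivity) ?_ two_ne_zero
    rw [Real.exp_neg, ← div_eq_mul_inv, div_lt_one (Real.exp_pos _)]
    linarith [Real.add_one_lt_exp (x := c / 4 - 1) (by linarith)]
  refine ⟨1 / (2 * B), by positivity, ?_⟩
  have hlim : Tendsto (fun n : ℕ => ENNReal.ofReal (1 - (16 * B ^ 3 / n + q ^ (n - 1))))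
      atTop (nhds 1) := by
    have h1 : Tendsto (fun n : ℕ => q ^ (n - 1)) atTop (nhds 0) :=
      (tendsto_pow_atTop_nhds_zero_of_lt_one (by positivity) hq).comp (tendsto_sub_atTop_nat 1)
    have h2 := ((tendsto_const_div_atTop_nhds_zero_nat (16 * B ^ 3)).add h1).const_sub 1
    simpa using ENNReal.tendsto_ofReal h2
  have hlarge : ∀ᶠ n : ℕ in atTop, c ≤ n := tendsto_natCast_atTop_atTop.eventually_ge_atTop c
  refine tendsto_of_tendsto_of_tendsto_of_le_of_le' hlim tendsto_const_nhds ?_ ?_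
  · filter_upwards [hlarge] with n hn
    have := isProbabilityMeasure_erdosRenyi (n := n) (p := c / n) (by positivity)
      (div_le_one_of_le₀ hn (by positivity))
    refine ENNReal.ofReal_le_of_le_toReal ?_
    rw [← measureReal_def, sub_le_comm, ← probReal_compl_eq_one_sub .of_discrete]
    refine le_trans ?_ (add_le_add (erdosRenyi_real_exists_small_dense_le hc.le hB hn)
      (erdosRenyi_real_few_edges_le hc.le hn))
    refine (measureReal_mono fun G hG => ?_).trans (measureReal_union_le _ _)
    by_contra hbad
    simp only [Set.mem_union, Set.mem_ofPred_eq, not_or, not_lt, not_exists, not_and,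
      not_le] at hbad
    have hn2 : 2 ≤ n := by
      have : (4 : ℝ) < n := hc.trans_le hn
      have : 4 < n := by exact_mod_cast this
      omega
    obtain ⟨S, h2, hd, hr⟩ := exists_isRigidOn_of_le_ncard_edgeSet hn2 hbad.2
    obtain ⟨T, hST, hT⟩ := hr.exists_isRigidComponent h2
    refine hG ⟨T, hT, le_trans ?_ (Nat.cast_le.2 (Finset.card_le_card hST))⟩
    by_contra! hlt
    exact (hbad.1 S h2 hlt).not_ge hd
  · filter_upwards [hlarge] with n hn
    have := isProbabilityMeasure_erdosRenyi (n := n) (p := c / n) (by positivity)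
      (div_le_one_of_le₀ hn (by positivity))
    exact prob_le_one
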